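/- arXiv:2402.04455 — 2 statements merged into one kernel-verified Lean document; each statement's English description precedes it below -/
import Mathlib

section
/- Let u : ℝ² → ℝ be a smooth function which is bounded from below or bounded from above, whose Euclidean gradient satisfies |∇u(x)| ≤ C for all x ∈ ℝ² and some constant C, and which satisfies the minimal surface equation div( ∇u/√(1 + |∇u|²) ) = 0 on all of ℝ². Then u is constant. -/
/-- The Euclidean divergence of a vector field `F : ℝ² → ℝ²`:
`div F = ∂F₁/∂x₁ + ∂F₂/∂x₂`. -/
noncomputable def ediv (F : EuclideanSpace ℝ (Fin 2) → EuclideanSpace ℝ (Fin 2))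
    (x : EuclideanSpace ℝ (Fin 2)) : ℝ :=
  ∑ i, fderiv ℝ F x (EuclideanSpace.single i 1) i

open MeasureTheory Filter Topology Set

local notation "ℝ²" => EuclideanSpace ℝ (Fin 2)

/-- The divergence theorem for a compactly supported test function. -/
lemma integral_fderiv_apply_eq_neg_integral_mul_ediv {F : ℝ² → ℝ²} {ψ : ℝ² → ℝ}
    (hF : ContDiff ℝ 1 F) (hψ : ContDiff ℝ 1 ψ) (hc : HasCompactSupport ψ) :
    ∫ x, fderiv ℝ ψ x (F x) = -∫ x, ψ x * ediv F x := by
  have hFi (i : Fin 2) : ContDiff ℝ 1 fun x => F x i := by fun_prop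
  have hFd (i : Fin 2) (x v : ℝ²) : fderiv ℝ (fun x => F x i) x v = fderiv ℝ F x v i := by
    have h := ((EuclideanSpace.proj i : ℝ² →L[ℝ] ℝ).hasFDerivAt.comp x
      (hF.differentiable (by norm_num) x).hasFDerivAt)
    have h' : HasFDerivAt (fun x => F x i)
      ((EuclideanSpace.proj i : ℝ² →L[ℝ] ℝ).comp (fderiv ℝ F x)) x := h
    rw [h'.fderiv]
    rfl
  have hψc : Continuous (fderiv ℝ ψ) := hψ.continuous_fderiv (by norm_num)
  have hFic (i : Fin 2) : Continuous fun x => fderiv ℝ (fun x => F x i) x :=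
    (hFi i).continuous_fderiv (by norm_num)
  have hint (i : Fin 2) : Integrable fun x => fderiv ℝ ψ x (EuclideanSpace.single i 1) * F x i := by
    refine Continuous.integrable_of_hasCompactSupport ?_ ?_
    · exact (hψc.clm_apply continuous_const).mul (hFi i).continuous
    · exact (hc.fderiv_apply ℝ _).mul_right
  have hint' (i : Fin 2) : Integrable fun x =>
      ψ x * fderiv ℝ (fun x => F x i) x (EuclideanSpace.single i 1) := by
    refine Continuous.integrable_of_hasCompactSupport ?_ hc.mul_right
    exact hψ.continuous.mul ((hFic i).clm_apply continuous_const)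
  have hparts (i : Fin 2) := integral_mul_fderiv_eq_neg_fderiv_mul_of_integrable
    (μ := volume) (hint i) (hint' i)
    ((hψ.continuous.mul (hFi i).continuous).integrable_of_hasCompactSupport hc.mul_right)
    (fun x _ => hψ.differentiable (by norm_num) x)
    (fun x _ => (hFi i).differentiable (by norm_num) x)
  have hsum (x : ℝ²) : fderiv ℝ ψ x (F x) =
      ∑ i, fderiv ℝ ψ x (EuclideanSpace.single i 1) * F x i := by
    have hFx : F x = ∑ i, F x i • EuclideanSpace.single i (1 : ℝ) := by
      ext j; fin_cases j <;> simp
    conv_lhs => rw [hFx]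
    simp [mul_comm]
  have hdiv (x : ℝ²) : ψ x * ediv F x =
      ∑ i, ψ x * fderiv ℝ (fun x => F x i) x (EuclideanSpace.single i 1) := by
    simp [ediv, hFd, mul_add]
  simp_rw [hsum, hdiv]
  rw [integral_finsetSum _ fun i _ => hint i, integral_finsetSum _ fun i _ => hint' i]
  simp_rw [hparts]
  simp

/-- A Caccioppoli inequality on the logarithmic scale. -/
lemma integral_sq_mul_norm_sq_div_sq_le {F : ℝ² → ℝ²} {w φ : ℝ² → ℝ}
    (hF : ContDiff ℝ 1 F) (hw : ContDiff ℝ 1 w) (hφ : ContDiff ℝ 1 φ) (hc : HasCompactSupport φ)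
    (hpos : ∀ x, 0 < w x) (hdiv : ∀ x, ediv F x = 0)
    (hFw : ∀ x, ‖F x‖ ^ 2 ≤ fderiv ℝ w x (F x)) :
    ∫ x, φ x ^ 2 * (‖F x‖ / w x) ^ 2 ≤ 4 * ∫ x, ‖fderiv ℝ φ x‖ ^ 2 := by
  have hψ : ContDiff ℝ 1 fun x => φ x ^ 2 * (w x)⁻¹ :=
    (hφ.pow 2).mul (hw.inv fun x => (hpos x).ne')
  have hc2 : HasCompactSupport fun x => φ x ^ 2 :=
    hc.comp_left (g := fun t => t ^ 2) (by simp)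
  have hψc : HasCompactSupport fun x => φ x ^ 2 * (w x)⁻¹ := hc2.mul_right
  have hzero : ∫ x, fderiv ℝ (fun x => φ x ^ 2 * (w x)⁻¹) x (F x) = 0 := by
    rw [integral_fderiv_apply_eq_neg_integral_mul_ediv hF hψ hψc]
    simp [hdiv]
  have hA : Integrable fun x => φ x ^ 2 * (‖F x‖ / w x) ^ 2 := by
    refine Continuous.integrable_of_hasCompactSupport ?_ hc2.mul_right
    exact (hφ.continuous.pow 2).mul
      ((hF.continuous.norm.div hw.continuous fun x => (hpos x).ne').pow 2)
  have hB : Integrable fun x => ‖fderiv ℝ φ x‖ ^ 2 := by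
    refine Continuous.integrable_of_hasCompactSupport
      ((hφ.continuous_fderiv (by norm_num)).norm.pow 2)
      ((hc.fderiv (𝕜 := ℝ)).comp_left (g := fun L => ‖L‖ ^ 2) (by simp))
  have hD : Integrable fun x => fderiv ℝ (fun x => φ x ^ 2 * (w x)⁻¹) x (F x) := by
    refine Continuous.integrable_of_hasCompactSupport
      ((hψ.continuous_fderiv (by norm_num)).clm_apply hF.continuous) ?_
    refine (hψc.fderiv (𝕜 := ℝ)).mono fun x hx => ?_
    contrapose! hx
    simp_all
  have hpt (x : ℝ²) : fderiv ℝ (fun x => φ x ^ 2 * (w x)⁻¹) x (F x) ≤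
      2 * ‖fderiv ℝ φ x‖ ^ 2 - 2⁻¹ * (φ x ^ 2 * (‖F x‖ / w x) ^ 2) := by
    have h1 := (hφ.differentiable (by norm_num) x).hasFDerivAt
    have h2 := (hw.differentiable (by norm_num) x).hasFDerivAt
    have h3 := (h1.pow 2).mul ((hasDerivAt_inv (hpos x).ne').comp_hasFDerivAt x h2)
    have h4 : fderiv ℝ (fun x => φ x ^ 2 * (w x)⁻¹) x (F x) =
        2 * (φ x / w x) * fderiv ℝ φ x (F x) - (φ x / w x) ^ 2 * fderiv ℝ w x (F x) := by
      have h5 : HasFDerivAt (fun x => φ x ^ 2 * (w x)⁻¹) _ x := h3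
      rw [h5.fderiv]
      have := (hpos x).ne'
      simp
      field_simp
      ring
    rw [h4]
    have h6 := mul_le_mul_of_nonneg_left (hFw x) (sq_nonneg (φ x / w x))
    have h7 : φ x ^ 2 * (‖F x‖ / w x) ^ 2 = (φ x / w x) ^ 2 * ‖F x‖ ^ 2 := by ring
    have h8 : 2 * (φ x / w x) * fderiv ℝ φ x (F x) ≤
        2 * (|φ x / w x| * (‖fderiv ℝ φ x‖ * ‖F x‖)) := by
      rw [mul_assoc]
      refine mul_le_mul_of_nonneg_left ((le_abs_self _).trans ?_) zero_le_two
      rw [abs_mul]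
      gcongr
      exact (fderiv ℝ φ x).le_opNorm (F x)
    rw [h7]
    nlinarith [sq_nonneg (2 * ‖fderiv ℝ φ x‖ - |φ x / w x| * ‖F x‖), sq_abs (φ x / w x)]
  have := integral_mono hD ((hB.const_mul 2).sub (hA.const_mul 2⁻¹)) hpt
  rw [hzero] at this
  simp only [Pi.sub_apply] at this
  rw [integral_sub (hB.const_mul 2) (hA.const_mul 2⁻¹), integral_const_mul,
    integral_const_mul] at this
  linarith
lemma integrableOn_and_integral_Ioi_mul_one_add_sq_rpow {ε : ℝ} (hε : 0 < ε) :
    IntegrableOn (fun y : ℝ => y * (1 + y ^ 2) ^ (-1 - ε)) (Ioi 0) ∧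
      ∫ y in Ioi (0 : ℝ), y * (1 + y ^ 2) ^ (-1 - ε) = (2 * ε)⁻¹ := by
  have hderiv : ∀ y ∈ Ici (0 : ℝ), HasDerivAt (fun y : ℝ => -(2 * ε)⁻¹ * (1 + y ^ 2) ^ (-ε))
      (y * (1 + y ^ 2) ^ (-1 - ε)) y := by
    intro y _
    have h1 : HasDerivAt (fun y : ℝ => 1 + y ^ 2) (2 * y) y := by
      simpa using (hasDerivAt_pow 2 y).const_add 1
    have h2 := (h1.rpow_const (p := -ε) (Or.inl (by positivity))).const_mul (-(2 * ε)⁻¹)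
    refine h2.congr_deriv ?_
    rw [show -1 - ε = -ε - 1 by ring]
    field_simp
  have hnonneg : ∀ y ∈ Ioi (0 : ℝ), 0 ≤ y * (1 + y ^ 2) ^ (-1 - ε) := by
    intro y hy
    have : 0 < y := hy
    positivity
  have hlim : Tendsto (fun y : ℝ => -(2 * ε)⁻¹ * (1 + y ^ 2) ^ (-ε)) atTop (𝓝 0) := by
    have h : Tendsto (fun y : ℝ => 1 + y ^ 2) atTop atTop :=
      tendsto_atTop_add_const_left _ _ (tendsto_pow_atTop two_ne_zero)
    simpa using ((tendsto_rpow_neg_atTop hε).comp h).const_mul (-(2 * ε)⁻¹)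
  refine ⟨integrableOn_Ioi_deriv_of_nonneg' hderiv hnonneg hlim, ?_⟩
  rw [integral_Ioi_of_hasDerivAt_of_nonneg' hderiv hnonneg hlim]
  simp

lemma integrable_and_integral_one_add_norm_sq_rpow {ε : ℝ} (hε : 0 < ε) :
    Integrable (fun x : ℝ² => (1 + ‖x‖ ^ 2) ^ (-1 - ε)) ∧
      ∫ x : ℝ², (1 + ‖x‖ ^ 2) ^ (-1 - ε) = volume.real (Metric.ball (0 : ℝ²) 1) / ε := by
  obtain ⟨h1, h2⟩ := integrableOn_and_integral_Ioi_mul_one_add_sq_rpow hε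
  constructor
  · rw [integrable_fun_norm_addHaar (μ := volume) (f := fun r : ℝ => (1 + r ^ 2) ^ (-1 - ε))]
    simpa using h1
  · rw [integral_fun_norm_addHaar (μ := volume) (fun r : ℝ => (1 + r ^ 2) ^ (-1 - ε))]
    simp only [finrank_euclideanSpace, Fintype.card_fin, Nat.add_one_sub_one, pow_one,
      smul_eq_mul, nsmul_eq_mul, h2]
    push_cast
    field_simp

/-- The logarithmic cutoff function. -/
noncomputable def logCutoff (n : ℝ) (x : ℝ²) : ℝ :=
  Real.smoothTransition (2 - Real.log (1 + ‖x‖ ^ 2) / n)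

lemma contDiff_logCutoff (n : ℝ) : ContDiff ℝ 1 (logCutoff n) := by
  refine (Real.smoothTransition.contDiff (n := 1)).comp
    (contDiff_const.sub (ContDiff.div_const ?_ n))
  exact (contDiff_const.add (contDiff_norm_sq ℝ)).log fun x => by positivity

lemma hasCompactSupport_logCutoff {n : ℝ} (hn : 0 < n) : HasCompactSupport (logCutoff n) := by
  refine HasCompactSupport.intro (isCompact_closedBall (0 : ℝ²) (Real.exp (2 * n))) fun x hx => ?_
  refine Real.smoothTransition.zero_of_nonpos ?_
  have h1 : Real.exp (2 * n) < ‖x‖ := by simpa using hx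
  have h2 : 1 < Real.exp (2 * n) := by simpa using hn
  have h3 : Real.exp (2 * n) ≤ 1 + ‖x‖ ^ 2 := by nlinarith
  have h4 : 2 * n ≤ Real.log (1 + ‖x‖ ^ 2) := (Real.le_log_iff_exp_le (by positivity)).2 h3
  rw [sub_nonpos, le_div_iff₀ hn]
  exact h4

lemma logCutoff_le_logCutoff {m n : ℝ} (hm : 0 < m) (hmn : m ≤ n) (x : ℝ²) :
    logCutoff m x ≤ logCutoff n x := by
  refine Real.smoothTransition.monotone ?_
  have : 0 ≤ Real.log (1 + ‖x‖ ^ 2) := Real.log_nonneg (by nlinarith [sq_nonneg ‖x‖])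
  gcongr

lemma exists_abs_deriv_smoothTransition_le : ∃ K, ∀ t, |deriv Real.smoothTransition t| ≤ K := by
  have hcont : Continuous (deriv Real.smoothTransition) :=
    (Real.smoothTransition.contDiff (n := 1)).continuous_deriv (by norm_num)
  have hsupp : HasCompactSupport (deriv Real.smoothTransition) := by
    refine HasCompactSupport.intro (isCompact_Icc (a := (0 : ℝ)) (b := 1)) fun t ht => ?_
    rcases not_and_or.1 ht with h | h
    · have : Real.smoothTransition =ᶠ[𝓝 t] fun _ => 0 := by
        filter_upwards [Iio_mem_nhds (not_le.1 h)] with s hs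
        exact Real.smoothTransition.zero_of_nonpos (le_of_lt hs)
      simp [this.deriv_eq]
    · have : Real.smoothTransition =ᶠ[𝓝 t] fun _ => 1 := by
        filter_upwards [Ioi_mem_nhds (not_le.1 h)] with s hs
        exact Real.smoothTransition.one_of_one_le (le_of_lt hs)
      simp [this.deriv_eq]
  obtain ⟨K, hK⟩ := hsupp.exists_bound_of_continuous hcont
  exact ⟨K, hK⟩

lemma norm_fderiv_logCutoff_sq_le {K n : ℝ} (hK : ∀ t, |deriv Real.smoothTransition t| ≤ K)
    (hn : 0 < n) (x : ℝ²) :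
    ‖fderiv ℝ (logCutoff n) x‖ ^ 2 ≤
      4 * K ^ 2 * Real.exp 2 / n ^ 2 * (1 + ‖x‖ ^ 2) ^ (-1 - n⁻¹) := by
  have hq : 0 < 1 + ‖x‖ ^ 2 := by positivity
  have hK0 : 0 ≤ K := (abs_nonneg _).trans (hK 0)
  by_cases hx : 2 * n < Real.log (1 + ‖x‖ ^ 2)
  · have hloc : logCutoff n =ᶠ[𝓝 x] fun _ => 0 := by
      have hcont : Continuous fun y : ℝ² => Real.log (1 + ‖y‖ ^ 2) :=
        Continuous.log (by fun_prop) fun y => by positivity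
      filter_upwards [hcont.continuousAt.eventually (Ioi_mem_nhds hx)] with y hy
      refine Real.smoothTransition.zero_of_nonpos ?_
      rw [sub_nonpos, le_div_iff₀ hn]
      exact le_of_lt hy
    rw [hloc.fderiv_eq]
    simp
    positivity
  · have h1 : HasFDerivAt (fun y : ℝ² => ‖y‖ ^ 2) (2 • innerSL ℝ x) x :=
      (hasStrictFDerivAt_norm_sq x).hasFDerivAt
    have h2 := (((h1.const_add 1).log hq.ne').const_mul n⁻¹).const_sub 2
    have h3 := ((Real.smoothTransition.contDiff (n := 1)).differentiable
      (by norm_num) (2 - n⁻¹ * Real.log (1 + ‖x‖ ^ 2))).hasDerivAt.comp_hasFDerivAt x h2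
    have h4 : logCutoff n = Real.smoothTransition ∘ fun y => 2 - n⁻¹ * Real.log (1 + ‖y‖ ^ 2) := by
      ext y
      simp [logCutoff, div_eq_inv_mul]
    rw [h4, h3.fderiv]
    have h5 : (1 + ‖x‖ ^ 2) ^ (-1 : ℝ) ≤ Real.exp 2 * (1 + ‖x‖ ^ 2) ^ (-1 - n⁻¹) := by
      rw [sub_eq_add_neg, Real.rpow_add hq, mul_left_comm]
      refine le_mul_of_one_le_right (by positivity) ?_
      rw [Real.rpow_def_of_pos hq, ← Real.exp_add]
      refine Real.one_le_exp ?_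
      have : Real.log (1 + ‖x‖ ^ 2) * n⁻¹ ≤ 2 := by
        rw [← div_eq_mul_inv, div_le_iff₀ hn]
        exact not_lt.1 hx
      linarith
    have h6 : ‖x‖ ^ 2 / (1 + ‖x‖ ^ 2) ^ 2 ≤ (1 + ‖x‖ ^ 2) ^ (-1 : ℝ) := by
      rw [Real.rpow_neg_one, div_le_iff₀ (by positivity), pow_two (1 + ‖x‖ ^ 2),
        inv_mul_cancel_left₀ hq.ne']
      linarith
    set d := deriv Real.smoothTransition (2 - n⁻¹ * Real.log (1 + ‖x‖ ^ 2))
    have h7 : d ^ 2 ≤ K ^ 2 := sq_le_sq' (abs_le.1 (hK _)).1 (abs_le.1 (hK _)).2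
    calc _ = 4 * d ^ 2 / n ^ 2 * (‖x‖ ^ 2 / (1 + ‖x‖ ^ 2) ^ 2) := by
          rw [← Nat.cast_smul_eq_nsmul ℝ]
          simp only [norm_smul, norm_neg, innerSL_apply_norm, mul_pow, norm_inv, Real.norm_eq_abs,
            inv_pow, sq_abs]
          push_cast
          field_simp
          ring
      _ ≤ 4 * K ^ 2 / n ^ 2 * (Real.exp 2 * (1 + ‖x‖ ^ 2) ^ (-1 - n⁻¹)) := by
          gcongr
          exact h6.trans h5
      _ = _ := by ring

/-- The plane is parabolic: the energy of the logarithmic cutoffs tends to zero. -/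
lemma tendsto_integral_norm_fderiv_logCutoff_sq :
    Tendsto (fun n => ∫ x, ‖fderiv ℝ (logCutoff n) x‖ ^ 2) atTop (𝓝 0) := by
  obtain ⟨K, hK⟩ := exists_abs_deriv_smoothTransition_le
  have hlim := tendsto_inv_atTop_zero.const_mul
    (4 * K ^ 2 * Real.exp 2 * volume.real (Metric.ball (0 : ℝ²) 1))
  rw [mul_zero] at hlim
  refine squeeze_zero' (Eventually.of_forall fun n => integral_nonneg fun x => by positivity) ?_ hlim
  filter_upwards [eventually_gt_atTop 0] with n hn
  obtain ⟨h1, h2⟩ := integrable_and_integral_one_add_norm_sq_rpow (inv_pos.2 hn)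
  calc _ ≤ ∫ x : ℝ², 4 * K ^ 2 * Real.exp 2 / n ^ 2 * (1 + ‖x‖ ^ 2) ^ (-1 - n⁻¹) :=
        integral_mono_of_nonneg (Eventually.of_forall fun x => by positivity) (h1.const_mul _)
          (Eventually.of_forall fun x => norm_fderiv_logCutoff_sq_le hK hn x)
    _ = _ := by
        rw [integral_const_mul, h2]
        field_simp

lemma eq_zero_of_ediv_eq_zero {F : ℝ² → ℝ²} {w : ℝ² → ℝ}
    (hF : ContDiff ℝ 1 F) (hw : ContDiff ℝ 1 w) (hpos : ∀ x, 0 < w x)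
    (hdiv : ∀ x, ediv F x = 0) (hFw : ∀ x, ‖F x‖ ^ 2 ≤ fderiv ℝ w x (F x)) (x : ℝ²) :
    F x = 0 := by
  by_contra hx
  have hcont (n : ℝ) : Continuous fun y => logCutoff n y ^ 2 * (‖F y‖ / w y) ^ 2 :=
    ((contDiff_logCutoff n).continuous.pow 2).mul
      ((hF.continuous.norm.div hw.continuous fun x => (hpos x).ne').pow 2)
  have hsupp {n : ℝ} (hn : 0 < n) :
      HasCompactSupport fun y => logCutoff n y ^ 2 * (‖F y‖ / w y) ^ 2 := by
    refine HasCompactSupport.mul_right ?_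
    exact (hasCompactSupport_logCutoff hn).comp_left (g := fun t => t ^ 2) (by simp)
  obtain ⟨N, hN, hNx⟩ : ∃ N : ℝ, 0 < N ∧ Real.log (1 + ‖x‖ ^ 2) ≤ N :=
    ⟨max 1 (Real.log (1 + ‖x‖ ^ 2)), by positivity, le_max_right _ _⟩
  have hNpos : 0 < ∫ y, logCutoff N y ^ 2 * (‖F y‖ / w y) ^ 2 := by
    refine (hcont N).integral_pos_of_hasCompactSupport_nonneg_nonzero (x := x) (hsupp hN)
      (fun y => by positivity) ?_
    have : logCutoff N x = 1 := by
      refine Real.smoothTransition.one_of_one_le ?_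
      have := (div_le_one hN).2 hNx
      linarith
    have := (hpos x).ne'
    simp_all
  have hlim := tendsto_integral_norm_fderiv_logCutoff_sq.const_mul 4
  rw [mul_zero] at hlim
  refine hNpos.not_ge (ge_of_tendsto hlim ?_)
  filter_upwards [eventually_ge_atTop N] with n hn
  have hn0 := hN.trans_le hn
  refine le_trans (integral_mono ((hcont N).integrable_of_hasCompactSupport (hsupp hN))
    ((hcont n).integrable_of_hasCompactSupport (hsupp hn0)) fun y => ?_)
    (integral_sq_mul_norm_sq_div_sq_le hF hw (contDiff_logCutoff n)
      (hasCompactSupport_logCutoff hn0) hpos hdiv hFw)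
  have h0 : 0 ≤ logCutoff N y := Real.smoothTransition.nonneg _
  have := logCutoff_le_logCutoff hN hn y
  dsimp only
  gcongr

lemma ediv_neg (F : ℝ² → ℝ²) (x : ℝ²) : ediv (fun y => -F y) x = -ediv F x := by
  simp [ediv, add_comm]

/-- Moser–Bernstein theorem in ℝ³ (Corollary 4.2 with P = ℝ², h ≡ 1): any
half-bounded entire solution with bounded gradient of the minimal surface
equation on ℝ² is constant. -/
theorem moser_bernstein_minimal_surface
    (u : EuclideanSpace ℝ (Fin 2) → ℝ) (hu : ContDiff ℝ (⊤ : ℕ∞) u)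
    (hbd : (∃ m, ∀ x, m ≤ u x) ∨ (∃ m, ∀ x, u x ≤ m))
    (C : ℝ) (hgrad : ∀ x, ‖gradient u x‖ ≤ C)
    (heq : ∀ x,
      ediv (fun y => (Real.sqrt (1 + ‖gradient u y‖ ^ 2))⁻¹ • gradient u y) x = 0) :
    ∃ c : ℝ, ∀ x, u x = c := by
  have hu1 : ContDiff ℝ 1 u := hu.of_le (by norm_cast)
  have hg : ContDiff ℝ 1 (gradient u) := by
    have h : ContDiff ℝ 1 (fderiv ℝ u) := hu.fderiv_right (by norm_cast)
    exact (InnerProductSpace.toDual ℝ ℝ²).symm.contDiff.comp h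
  have hq : ∀ y, 0 < 1 + ‖gradient u y‖ ^ 2 := fun y => by positivity
  have hF : ContDiff ℝ 1 fun y => (Real.sqrt (1 + ‖gradient u y‖ ^ 2))⁻¹ • gradient u y :=
    (((contDiff_const.add (hg.norm_sq ℝ)).sqrt fun y => (hq y).ne').inv
      fun y => (Real.sqrt_pos.2 (hq y)).ne').smul hg
  have hFu (x : ℝ²) : ‖(Real.sqrt (1 + ‖gradient u x‖ ^ 2))⁻¹ • gradient u x‖ ^ 2 ≤
      fderiv ℝ u x ((Real.sqrt (1 + ‖gradient u x‖ ^ 2))⁻¹ • gradient u x) := by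
    have h1 : 1 ≤ Real.sqrt (1 + ‖gradient u x‖ ^ 2) := by
      rw [Real.one_le_sqrt]
      nlinarith [sq_nonneg ‖gradient u x‖]
    have h2 := inv_le_one_of_one_le₀ h1
    have h3 : 0 ≤ (Real.sqrt (1 + ‖gradient u x‖ ^ 2))⁻¹ := by positivity
    rw [map_smul, ← inner_gradient_left, real_inner_self_eq_norm_sq, norm_smul, mul_pow,
      Real.norm_of_nonneg h3, smul_eq_mul]
    gcongr
    nlinarith
  have hzero (x : ℝ²) : (Real.sqrt (1 + ‖gradient u x‖ ^ 2))⁻¹ • gradient u x = 0 := by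
    rcases hbd with ⟨m, hm⟩ | ⟨m, hm⟩
    · refine eq_zero_of_ediv_eq_zero (w := fun y => u y + (1 - m)) hF
        (hu1.add contDiff_const) (fun y => by linarith [hm y]) heq (fun y => ?_) x
      rw [fderiv_add_const]
      exact hFu y
    · refine neg_eq_zero.1 (eq_zero_of_ediv_eq_zero
        (F := fun y => -((Real.sqrt (1 + ‖gradient u y‖ ^ 2))⁻¹ • gradient u y))
        (w := fun y => (m + 1) - u y) hF.neg
        (contDiff_const.sub hu1) (fun y => by linarith [hm y])
        (fun y => by rw [ediv_neg, heq, neg_zero]) (fun y => ?_) x)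
      rw [fderiv_const_sub, norm_neg, neg_apply, map_neg, neg_neg]
      exact hFu y
  have hfderiv (x : ℝ²) : fderiv ℝ u x = 0 := by
    have h := (smul_eq_zero.1 (hzero x)).resolve_left (inv_ne_zero (Real.sqrt_pos.2 (hq x)).ne')
    rw [← toDual_gradient, h, map_zero]
  exact ⟨u 0, fun x => is_const_of_fderiv_eq_zero (hu1.differentiable (by norm_num)) hfderiv x 0⟩
end

section
/- Let u : ℝ² → ℝ be a smooth function which is bounded from below, whose Euclidean gradient satisfies |∇u(x)| ≤ C for all x ∈ ℝ² and some constant C, and which satisfies the differential inequality div( ∇u/√(1 + |∇u|²) ) ≤ 0 on all of ℝ². Then u is constant. -/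
open MeasureTheory Metric Filter Topology

/-- Cutoff functions on the plane which are one on arbitrarily large balls and have constant
Dirichlet energy; this uses the conformal invariance of the energy in dimension two. -/
theorem exists_cutoff_energy_le :
    ∃ K : ℝ, ∀ R : ℝ, 0 < R → ∃ φ : EuclideanSpace ℝ (Fin 2) → ℝ,
      ContDiff ℝ 1 φ ∧ HasCompactSupport φ ∧ (∀ x, 0 ≤ φ x) ∧ (∀ x, φ x ≤ 1) ∧
      (∀ x ∈ ball 0 R, φ x = 1) ∧ ∫ x, ‖fderiv ℝ φ x‖ ^ 2 ≤ K := by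
  let χ : ContDiffBump (0 : EuclideanSpace ℝ (Fin 2)) := ⟨1, 2, by norm_num, by norm_num⟩
  refine ⟨∫ x, ‖fderiv ℝ χ x‖ ^ 2, fun R hR => ?_⟩
  refine ⟨fun x => χ (R⁻¹ • x), χ.contDiff.comp (contDiff_const_smul _),
    χ.hasCompactSupport.comp_smul (inv_ne_zero hR.ne'), fun x => χ.nonneg, fun x => χ.le_one,
    fun x hx => χ.one_of_mem_closedBall ?_, ?_⟩
  · rw [mem_ball_zero_iff] at hx
    rw [mem_closedBall_zero_iff, norm_smul, norm_inv, Real.norm_of_nonneg hR.le,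
      inv_mul_le_iff₀ hR]
    simpa [χ] using hx.le
  · have hd : ∀ x, ‖fderiv ℝ (fun x => χ (R⁻¹ • x)) x‖ ^ 2
        = (R⁻¹) ^ 2 * ‖fderiv ℝ χ (R⁻¹ • x)‖ ^ 2 := fun x => by
      rw [fderiv_comp_smul, norm_smul, Real.norm_of_nonneg (inv_nonneg.2 hR.le), mul_pow]
    simp_rw [hd]
    rw [integral_const_mul,
      Measure.integral_comp_smul volume (fun x => ‖fderiv ℝ χ x‖ ^ 2) R⁻¹,
      finrank_euclideanSpace_fin, abs_of_nonneg (by positivity), smul_eq_mul, ← mul_assoc,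
      mul_inv_cancel₀ (by positivity), one_mul]

/-- The weak form of `div F ≤ 0`. -/
theorem integral_fderiv_apply_nonneg_of_ediv_nonpos
    {F : EuclideanSpace ℝ (Fin 2) → EuclideanSpace ℝ (Fin 2)} (hF : ContDiff ℝ 1 F)
    (hdiv : ∀ x, ediv F x ≤ 0) {f : EuclideanSpace ℝ (Fin 2) → ℝ} (hf : ContDiff ℝ 1 f)
    (hfc : HasCompactSupport f) (hf0 : ∀ x, 0 ≤ f x) :
    0 ≤ ∫ x, fderiv ℝ f x (F x) := by
  have hdf := hf.continuous_fderiv one_ne_zero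
  have hdF := hF.continuous_fderiv one_ne_zero
  have hFi : ∀ i x, fderiv ℝ (fun y => F y i) x (EuclideanSpace.single i 1)
      = fderiv ℝ F x (EuclideanSpace.single i 1) i := fun i x => by
    have := ((EuclideanSpace.proj (𝕜 := ℝ) i).hasFDerivAt.comp x
      (hF.differentiable one_ne_zero x).hasFDerivAt).fderiv
    exact congrArg (fun L => L (EuclideanSpace.single i (1 : ℝ))) this
  have hi1 : ∀ i, Integrable fun x => fderiv ℝ f x (EuclideanSpace.single i 1) * F x i :=
    fun i => Continuous.integrable_of_hasCompactSupport (by fun_prop)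
      ((hfc.fderiv_apply (𝕜 := ℝ) _).mul_right)
  have hi2 : ∀ i, Integrable fun x => f x * fderiv ℝ F x (EuclideanSpace.single i 1) i :=
    fun i => Continuous.integrable_of_hasCompactSupport (by fun_prop) hfc.mul_right
  have parts : ∀ i, ∫ x, f x * fderiv ℝ F x (EuclideanSpace.single i 1) i
      = -∫ x, fderiv ℝ f x (EuclideanSpace.single i 1) * F x i := fun i => by
    have := integral_mul_fderiv_eq_neg_fderiv_mul_of_integrable (μ := volume) (f := f)
      (g := fun y => F y i) (v := EuclideanSpace.single i (1 : ℝ)) (hi1 i)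
      (by simp_rw [hFi]; exact hi2 i)
      (Continuous.integrable_of_hasCompactSupport (by fun_prop) hfc.mul_right)
      (fun x _ => hf.differentiable one_ne_zero x)
      (fun x _ => by have := hF.differentiable one_ne_zero x; fun_prop)
    simp_rw [hFi] at this
    exact this
  have expand : ∀ x, fderiv ℝ f x (F x)
      = ∑ i, fderiv ℝ f x (EuclideanSpace.single i 1) * F x i := fun x => by
    conv_lhs => rw [← (EuclideanSpace.basisFun (Fin 2) ℝ).sum_repr (F x)]
    simp [mul_comm]
  have key : ∫ x, fderiv ℝ f x (F x) = -∫ x, f x * ediv F x := by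
    simp_rw [expand, ediv, Finset.mul_sum]
    rw [integral_finsetSum _ fun i _ => hi1 i, integral_finsetSum _ fun i _ => hi2 i]
    simp [parts]
  rw [key, ← integral_neg]
  exact integral_nonneg fun x => by
    have := mul_nonpos_of_nonneg_of_nonpos (hf0 x) (hdiv x)
    simpa using this

/-- A Caccioppoli inequality for the logarithm of a positive function `v` carrying a field `F` with
`div F ≤ 0`. -/
theorem integral_sq_mul_le_of_ediv_nonpos
    {F : EuclideanSpace ℝ (Fin 2) → EuclideanSpace ℝ (Fin 2)} (hF : ContDiff ℝ 1 F)
    (hdiv : ∀ x, ediv F x ≤ 0) {v : EuclideanSpace ℝ (Fin 2) → ℝ} (hv : ContDiff ℝ 1 v)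
    (hv0 : ∀ x, 0 < v x) (hFv : ∀ x, ‖F x‖ ^ 2 ≤ fderiv ℝ v x (F x))
    {φ : EuclideanSpace ℝ (Fin 2) → ℝ} (hφ : ContDiff ℝ 1 φ) (hφc : HasCompactSupport φ)
    (hφ0 : ∀ x, 0 ≤ φ x) {R : ℝ} (hφR : ∀ x ∈ ball 0 R, φ x = 1) {ε : ℝ} (hε : 0 < ε) :
    ∫ x, φ x ^ 2 * (fderiv ℝ v x (F x) / v x ^ 2) ≤ ε * (∫ x, ‖fderiv ℝ φ x‖ ^ 2)
      + ε⁻¹ * ∫ x in (ball 0 R)ᶜ, φ x ^ 2 * (fderiv ℝ v x (F x) / v x ^ 2) := by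
  have hdv := hv.continuous_fderiv one_ne_zero
  have hdφ := hφ.continuous_fderiv one_ne_zero
  have hv' : ∀ x, v x ≠ 0 := fun x => (hv0 x).ne'
  have hv2 : ∀ x, v x ^ 2 ≠ 0 := fun x => pow_ne_zero 2 (hv' x)
  set E : EuclideanSpace ℝ (Fin 2) → ℝ := fun x => fderiv ℝ v x (F x) / v x ^ 2 with hE
  have hEc : Continuous E := by
    have := hF.continuous
    have := hv.continuous
    fun_prop (disch := assumption)
  have hE0 : ∀ x, 0 ≤ E x := fun x => div_nonneg ((sq_nonneg _).trans (hFv x)) (sq_nonneg _)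
  have hφsq : HasCompactSupport fun x => φ x ^ 2 :=
    hφc.comp_left (g := fun t : ℝ => t ^ 2) (by simp)
  have hI : Integrable fun x => φ x ^ 2 * E x :=
    Continuous.integrable_of_hasCompactSupport (by fun_prop) hφsq.mul_right
  have hJ : Integrable fun x => ‖fderiv ℝ φ x‖ ^ 2 :=
    Continuous.integrable_of_hasCompactSupport (by fun_prop)
      ((hφc.fderiv (𝕜 := ℝ)).comp_left (g := fun L => ‖L‖ ^ 2) (by simp))
  have hG : Integrable fun x => 2 * φ x / v x * fderiv ℝ φ x (F x) := by
    refine Continuous.integrable_of_hasCompactSupport ?_ ?_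
    · have := hF.continuous
      have := hv.continuous
      fun_prop (disch := assumption)
    · exact hφc.mono fun x hx h => hx (by simp [h])
  have hfd : ∀ x, fderiv ℝ (fun y => φ y ^ 2 * (v y)⁻¹) x (F x)
      = 2 * φ x / v x * fderiv ℝ φ x (F x) - φ x ^ 2 * E x := fun x => by
    have h1 := (hφ.differentiable one_ne_zero x).hasFDerivAt.pow 2
    have h2 := (hasDerivAt_inv (hv' x)).comp_hasFDerivAt x
      (hv.differentiable one_ne_zero x).hasFDerivAt
    have h3 := (h1.mul h2).fderiv
    have h4 := congrArg (fun L => L (F x)) h3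
    refine Eq.trans h4 ?_
    simp [hE]
    field_simp
    ring
  have hweak := integral_fderiv_apply_nonneg_of_ediv_nonpos hF hdiv
    (f := fun y => φ y ^ 2 * (v y)⁻¹) ((hφ.pow 2).mul (hv.inv hv')) hφsq.mul_right
    fun x => mul_nonneg (sq_nonneg _) (inv_nonneg.2 (hv0 x).le)
  simp_rw [hfd] at hweak
  rw [integral_sub hG hI, sub_nonneg] at hweak
  refine hweak.trans ?_
  rw [← integral_indicator measurableSet_ball.compl, ← integral_const_mul, ← integral_const_mul,
    ← integral_add (hJ.const_mul _) ((hI.indicator measurableSet_ball.compl).const_mul _)]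
  refine integral_mono hG
    ((hJ.const_mul _).add ((hI.indicator measurableSet_ball.compl).const_mul _)) fun x => ?_
  by_cases hx : x ∈ ball 0 R
  · have h0 : fderiv ℝ φ x = 0 := by
      have : φ =ᶠ[𝓝 x] fun _ => 1 := by
        filter_upwards [isOpen_ball.mem_nhds hx] with y hy using hφR y hy
      rw [this.fderiv_eq, fderiv_const_apply]
    simp [h0, hx]
  · have hind : (ball 0 R)ᶜ.indicator (fun x => φ x ^ 2 * E x) x = φ x ^ 2 * E x :=
      Set.indicator_of_mem hx _
    simp only [hind]
    have h1 : fderiv ℝ φ x (F x) ≤ ‖fderiv ℝ φ x‖ * ‖F x‖ :=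
      (le_abs_self _).trans ((fderiv ℝ φ x).le_opNorm _)
    set a := ‖fderiv ℝ φ x‖
    set b := φ x / v x * ‖F x‖ with hb
    have hq : 0 ≤ φ x / v x := div_nonneg (hφ0 x) (hv0 x).le
    have h2 : 2 * φ x / v x * fderiv ℝ φ x (F x) ≤ 2 * (a * b) := by
      calc 2 * φ x / v x * fderiv ℝ φ x (F x)
          = 2 * (φ x / v x * fderiv ℝ φ x (F x)) := by ring
        _ ≤ 2 * (φ x / v x * (a * ‖F x‖)) := by gcongr
        _ = 2 * (a * b) := by rw [hb]; ring
    have h3 : b ^ 2 ≤ φ x ^ 2 * E x := by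
      calc b ^ 2 = (φ x / v x) ^ 2 * ‖F x‖ ^ 2 := by rw [hb]; ring
        _ ≤ (φ x / v x) ^ 2 * fderiv ℝ v x (F x) := by gcongr; exact hFv x
        _ = φ x ^ 2 * E x := by rw [hE]; ring
    have h4 : 2 * (a * b) ≤ ε * a ^ 2 + ε⁻¹ * b ^ 2 := by
      have : 0 ≤ ε⁻¹ * (ε * a - b) ^ 2 := by positivity
      have e : ε⁻¹ * (ε * a - b) ^ 2 = ε * a ^ 2 + ε⁻¹ * b ^ 2 - 2 * (a * b) := by
        field_simp
        ring
      linarith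
    have h5 : ε⁻¹ * b ^ 2 ≤ ε⁻¹ * (φ x ^ 2 * E x) := by gcongr
    linarith

/-- A Liouville theorem on the plane: a field `F` with `div F ≤ 0` satisfying `|F|² ≤ F · ∇v` for
some positive function `v` vanishes. -/
theorem eq_zero_of_ediv_nonpos
    {F : EuclideanSpace ℝ (Fin 2) → EuclideanSpace ℝ (Fin 2)} (hF : ContDiff ℝ 1 F)
    (hdiv : ∀ x, ediv F x ≤ 0) {v : EuclideanSpace ℝ (Fin 2) → ℝ} (hv : ContDiff ℝ 1 v)
    (hv0 : ∀ x, 0 < v x) (hFv : ∀ x, ‖F x‖ ^ 2 ≤ fderiv ℝ v x (F x))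
    (x : EuclideanSpace ℝ (Fin 2)) : F x = 0 := by
  obtain ⟨K, hK⟩ := exists_cutoff_energy_le
  have hdv := hv.continuous_fderiv one_ne_zero
  have hv2 : ∀ x, v x ^ 2 ≠ 0 := fun x => pow_ne_zero 2 (hv0 x).ne'
  set E : EuclideanSpace ℝ (Fin 2) → ℝ := fun x => fderiv ℝ v x (F x) / v x ^ 2 with hE
  have hEc : Continuous E := by
    have := hF.continuous
    have := hv.continuous
    fun_prop (disch := assumption)
  have hE0 : ∀ x, 0 ≤ E x := fun x => div_nonneg ((sq_nonneg _).trans (hFv x)) (sq_nonneg _)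
  have hEball : ∀ R : ℝ, IntegrableOn E (ball 0 R) := fun R =>
    (hEc.continuousOn.integrableOn_compact (isCompact_closedBall 0 R)).mono_set ball_subset_closedBall
  have cutoff : ∀ R : ℝ, 0 < R → ∀ ε : ℝ, 0 < ε → ∃ φ : EuclideanSpace ℝ (Fin 2) → ℝ,
      Integrable (fun x => φ x ^ 2 * E x) ∧ (∀ x, 0 ≤ φ x ^ 2 * E x) ∧
      (∀ x, φ x ^ 2 * E x ≤ E x) ∧ ∫ x in ball 0 R, E x ≤ ∫ x, φ x ^ 2 * E x ∧
      ∫ x, φ x ^ 2 * E x ≤ ε * K + ε⁻¹ * ∫ x in (ball 0 R)ᶜ, φ x ^ 2 * E x := by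
    intro R hR ε hε
    obtain ⟨φ, hφ, hφc, hφ0, hφ1, hφR, hφK⟩ := hK R hR
    have hI : Integrable fun x => φ x ^ 2 * E x :=
      Continuous.integrable_of_hasCompactSupport (by have := hφ.continuous; fun_prop)
        (hφc.comp_left (g := fun t : ℝ => t ^ 2) (by simp)).mul_right
    have h0 : ∀ x, 0 ≤ φ x ^ 2 * E x := fun x => mul_nonneg (sq_nonneg _) (hE0 x)
    refine ⟨φ, hI, h0, fun x => mul_le_of_le_one_left (hE0 x) (pow_le_one₀ (hφ0 x) (hφ1 x)),
      ?_, ?_⟩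
    · calc ∫ x in ball 0 R, E x = ∫ x in ball 0 R, φ x ^ 2 * E x :=
            setIntegral_congr_fun measurableSet_ball fun x hx => by simp [hφR x hx]
        _ ≤ ∫ x, φ x ^ 2 * E x := setIntegral_le_integral hI (ae_of_all _ h0)
    · refine (integral_sq_mul_le_of_ediv_nonpos hF hdiv hv hv0 hFv hφ hφc hφ0 hφR hε).trans ?_
      gcongr
  have hEi : Integrable E := by
    refine (aecover_ball (μ := volume) (x := (0 : EuclideanSpace ℝ (Fin 2)))
      (tendsto_id (x := (atTop : Filter ℝ)))).integrable_of_integral_norm_bounded (4 * K)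
      hEball ?_
    filter_upwards [eventually_gt_atTop (0 : ℝ)] with R hR
    obtain ⟨φ, hI, h0, -, h2, h3⟩ := cutoff R hR 2 two_pos
    have h4 : ∫ x in (ball 0 R)ᶜ, φ x ^ 2 * E x ≤ ∫ x, φ x ^ 2 * E x :=
      setIntegral_le_integral hI (ae_of_all _ h0)
    simp_rw [Real.norm_of_nonneg (hE0 _), id]
    linarith
  have hlim : Tendsto (fun R : ℝ => ∫ x in ball 0 R, E x) atTop (𝓝 (∫ x, E x)) :=
    (aecover_ball tendsto_id).integral_tendsto_of_countably_generated hEi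
  have hle : ∀ ε : ℝ, 0 < ε → ∫ x, E x ≤ ε * K := fun ε hε => by
    have hlim' : Tendsto (fun R : ℝ => ε * K + ε⁻¹ * ((∫ x, E x) - ∫ x in ball 0 R, E x)) atTop
        (𝓝 (ε * K + ε⁻¹ * ((∫ x, E x) - ∫ x, E x))) :=
      ((hlim.const_sub _).const_mul _).const_add _
    rw [sub_self, mul_zero, add_zero] at hlim'
    refine le_of_tendsto_of_tendsto hlim hlim' ?_
    filter_upwards [eventually_gt_atTop (0 : ℝ)] with R hR
    obtain ⟨φ, hI, -, h1, h2, h3⟩ := cutoff R hR ε hε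
    have h4 : ∫ x in (ball 0 R)ᶜ, φ x ^ 2 * E x ≤ ∫ x in (ball 0 R)ᶜ, E x :=
      integral_mono hI.integrableOn hEi.integrableOn h1
    have h5 := integral_add_compl (measurableSet_ball (x := 0) (ε := R)) hEi
    refine h2.trans (h3.trans ?_)
    gcongr
    linarith
  have hzero : ∫ x, E x = 0 := by
    refine le_antisymm ?_ (integral_nonneg hE0)
    have hlimε : Tendsto (fun ε : ℝ => ε * K) (𝓝[>] 0) (𝓝 0) := by
      have : Tendsto (fun ε : ℝ => ε * K) (𝓝 0) (𝓝 (0 * K)) := tendsto_id.mul_const K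
      rw [zero_mul] at this
      exact this.mono_left nhdsWithin_le_nhds
    exact ge_of_tendsto hlimε (eventually_mem_nhdsWithin.mono fun ε hε => hle ε hε)
  have hE00 : E = 0 :=
    (hEc.ae_eq_iff_eq volume continuous_zero).1 ((integral_eq_zero_iff_of_nonneg hE0 hEi).1 hzero)
  have hx : fderiv ℝ v x (F x) = 0 := by
    have := congrFun hE00 x
    simpa [hE, (hv0 x).ne'] using this
  have := hFv x
  rw [hx] at this
  exact norm_eq_zero.1 (pow_eq_zero_iff two_ne_zero |>.1 (le_antisymm this (sq_nonneg _)))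

/-- Theorem 4.1 of the paper with P = ℝ² and h ≡ 1: an entire graph in ℝ³ with
non-positive mean curvature, bounded from below and with bounded gradient,
is a slice, i.e. u is constant. -/
theorem graph_nonpos_mean_curvature_bounded_below_euclidean
    (u : EuclideanSpace ℝ (Fin 2) → ℝ) (hu : ContDiff ℝ (⊤ : ℕ∞) u)
    (hbd : ∃ m, ∀ x, m ≤ u x)
    (C : ℝ) (hgrad : ∀ x, ‖gradient u x‖ ≤ C)
    (hineq : ∀ x,
      ediv (fun y => (Real.sqrt (1 + ‖gradient u y‖ ^ 2))⁻¹ • gradient u y) x ≤ 0) :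
    ∃ c : ℝ, ∀ x, u x = c := by
  obtain ⟨m, hm⟩ := hbd
  have hpos : ∀ x, 0 < 1 + ‖gradient u x‖ ^ 2 := fun x => by positivity
  have hg : ContDiff ℝ 1 (gradient u) :=
    (InnerProductSpace.toDual ℝ (EuclideanSpace ℝ (Fin 2))).symm.contDiff.comp
      (hu.fderiv_right (m := 1) (by norm_cast))
  have hF : ContDiff ℝ 1
      fun y => (Real.sqrt (1 + ‖gradient u y‖ ^ 2))⁻¹ • gradient u y :=
    (((contDiff_const.add (hg.norm_sq ℝ)).sqrt fun x => (hpos x).ne').inv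
      fun x => (Real.sqrt_pos.2 (hpos x)).ne').smul hg
  have hu1 : ContDiff ℝ 1 u := hu.of_le (by exact_mod_cast le_top)
  have hzero := eq_zero_of_ediv_nonpos hF hineq (v := fun x => u x - m + 1)
    ((hu1.sub contDiff_const).add contDiff_const) (fun x => by linarith [hm x]) fun x => by
      have hs : 1 ≤ Real.sqrt (1 + ‖gradient u x‖ ^ 2) :=
        Real.one_le_sqrt.2 (by linarith [sq_nonneg ‖gradient u x‖])
      rw [fderiv_add_const, fderiv_sub_const, map_smul, ← inner_gradient_left,
        real_inner_self_eq_norm_sq, norm_smul, mul_pow, smul_eq_mul,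
        Real.norm_of_nonneg (by positivity)]
      gcongr
      exact pow_le_of_le_one (by positivity) (inv_le_one_of_one_le₀ hs) two_ne_zero
  have hd : ∀ x, fderiv ℝ u x = 0 := fun x => by
    have h := (smul_eq_zero.1 (hzero x)).resolve_left
      (inv_ne_zero (Real.sqrt_pos.2 (hpos x)).ne')
    rw [← toDual_gradient, h, map_zero]
  exact ⟨u 0, fun x => is_const_of_fderiv_eq_zero (hu1.differentiable one_ne_zero) hd x 0⟩
end
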